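/- arXiv:2601.08710 — 2 statements merged into one kernel-verified Lean document; each statement's English description precedes it below -/
import Mathlib

section
/- For the equational theory EL (= bSLmO), if σ and θ are substitutions with σ ≤_EL^V θ, then for all x ∈ V: the role depth of σ(x) is bounded by the role depth of θ(x), and every role name occurring in σ(x) also occurs in θ(x). -/
namespace UnifFW

/-- First-order terms over a signature `F` (an arity-indexed family of function
symbols), with variables from the countably infinite set `V = ℕ`. -/
inductive Term (F : ℕ → Type) : Type
  | var : ℕ → Term F
  | app : (n : ℕ) → F n → (Fin n → Term F) → Term F

variable {F : ℕ → Type}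

/-- The set of variables occurring in a term. -/
def Term.vars : Term F → Set ℕ
  | .var x => {x}
  | .app _ _ ts => ⋃ i, (ts i).vars

/-- Homomorphic extension of a map `V → T(Σ,V)` to terms. -/
def Term.subst (σ : ℕ → Term F) : Term F → Term F
  | .var x => σ x
  | .app n f ts => .app n f (fun i => (ts i).subst σ)

/-- The congruence `≈_E` induced by a set `E` of identities: the smallest
equivalence relation containing all substitution instances of identities of `E`
and compatible with the term constructors. -/
inductive EqE (E : Set (Term F × Term F)) : Term F → Term F → Prop
  | ax {s t : Term F} (σ : ℕ → Term F) : (s, t) ∈ E → EqE E (s.subst σ) (t.subst σ)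
  | refl (t : Term F) : EqE E t t
  | symm {s t : Term F} : EqE E s t → EqE E t s
  | trans {s t u : Term F} : EqE E s t → EqE E t u → EqE E s u
  | congr {n : ℕ} (f : F n) {ts us : Fin n → Term F} :
      (∀ i, EqE E (ts i) (us i)) → EqE E (.app n f ts) (.app n f us)

/-- A theory is non-trivial if distinct variables are not equated. -/
def NonTrivial (E : Set (Term F × Term F)) : Prop :=
  ∀ x y : ℕ, x ≠ y → ¬ EqE E (.var x) (.var y)

/-- A theory is regular if both sides of each identity have the same variables. -/
def Regular (E : Set (Term F × Term F)) : Prop :=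
  ∀ p ∈ E, (Prod.fst p).vars = (Prod.snd p).vars

/-- A substitution: a map `V → T(Σ,V)` with finite domain. -/
structure Subst (F : ℕ → Type) where
  toFun : ℕ → Term F
  finite_dom : {x : ℕ | toFun x ≠ Term.var x}.Finite

/-- The domain of a substitution. -/
def Subst.Dom (σ : Subst F) : Set ℕ := {x : ℕ | σ.toFun x ≠ Term.var x}

/-- The variable range of a substitution: all variables occurring in the images
of domain variables. -/
def Subst.VRan (σ : Subst F) : Set ℕ := ⋃ x ∈ σ.Dom, (σ.toFun x).vars

/-- The instantiation preorder `σ ≤_E^X θ`: some substitution `λ` satisfies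
`λ(σ(x)) ≈_E θ(x)` for all `x ∈ X`. -/
def InstLE (E : Set (Term F × Term F)) (X : Set ℕ) (σ θ : Subst F) : Prop :=
  ∃ lam : Subst F, ∀ x ∈ X, EqE E ((σ.toFun x).subst lam.toFun) (θ.toFun x)

/-- The equivalence `σ ∼_E^X θ` induced by the instantiation preorder. -/
def InstEquiv (E : Set (Term F × Term F)) (X : Set ℕ) (σ θ : Subst F) : Prop :=
  InstLE E X σ θ ∧ InstLE E X θ σ

/-- The strict instantiation order `σ <_E^X θ`. -/
def InstLT (E : Set (Term F × Term F)) (X : Set ℕ) (σ θ : Subst F) : Prop :=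
  InstLE E X σ θ ∧ ¬ InstLE E X θ σ

/-- The set of variables occurring in a unification problem. -/
def VarsP (Γ : Set (Term F × Term F)) : Set ℕ :=
  ⋃ p ∈ Γ, (Prod.fst p).vars ∪ (Prod.snd p).vars

/-- `σ` is an `E`-unifier of the unification problem `Γ`. -/
def Unifier (E Γ : Set (Term F × Term F)) (σ : Subst F) : Prop :=
  ∀ p ∈ Γ, EqE E ((Prod.fst p).subst σ.toFun) ((Prod.snd p).subst σ.toFun)

/-- A unification problem is solvable if it has a unifier. -/
def Solvable (E Γ : Set (Term F × Term F)) : Prop := ∃ σ : Subst F, Unifier E Γ σ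

/-- `S` is a complete set of `E`-unifiers of `Γ` w.r.t. `≤_E^X`. -/
def CompleteSet (E Γ : Set (Term F × Term F)) (X : Set ℕ) (S : Set (Subst F)) : Prop :=
  (∀ σ ∈ S, Unifier E Γ σ) ∧ ∀ θ : Subst F, Unifier E Γ θ → ∃ σ ∈ S, InstLE E X σ θ

/-- `S` is a minimal complete set of `E`-unifiers of `Γ` w.r.t. `≤_E^X`:
complete, and no two distinct elements are comparable. -/
def MinimalComplete (E Γ : Set (Term F × Term F)) (X : Set ℕ) (S : Set (Subst F)) : Prop :=
  CompleteSet E Γ X S ∧ ∀ σ ∈ S, ∀ θ ∈ S, σ ≠ θ → ¬ InstLE E X σ θ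

/-- `Γ` has unification type unitary w.r.t. `≤_E^X`. -/
def TypeUnitary (E Γ : Set (Term F × Term F)) (X : Set ℕ) : Prop :=
  ∃ σ : Subst F, MinimalComplete E Γ X {σ}

/-- `Γ` has unification type finitary w.r.t. `≤_E^X`. -/
def TypeFinitary (E Γ : Set (Term F × Term F)) (X : Set ℕ) : Prop :=
  ∃ S : Set (Subst F), MinimalComplete E Γ X S ∧ S.Finite ∧ 1 < S.ncard

/-- `Γ` has unification type infinitary w.r.t. `≤_E^X`. -/
def TypeInfinitary (E Γ : Set (Term F × Term F)) (X : Set ℕ) : Prop :=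
  ∃ S : Set (Subst F), MinimalComplete E Γ X S ∧ S.Infinite

/-- `Γ` has unification type zero w.r.t. `≤_E^X`. -/
def TypeZero (E Γ : Set (Term F × Term F)) (X : Set ℕ) : Prop :=
  ¬ ∃ S : Set (Subst F), MinimalComplete E Γ X S

/-- `σ` is a `≤_E^X`-minimal `E`-unifier of `Γ`. -/
def MinUnifier (E Γ : Set (Term F × Term F)) (X : Set ℕ) (σ : Subst F) : Prop :=
  Unifier E Γ σ ∧ ∀ θ : Subst F, Unifier E Γ θ → InstLE E X θ σ → InstLE E X σ θ

/-- The set `C_E(Γ)` of unifiers all of whose range variables occur in the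
images of at least two distinct variables. -/
def CSet (E Γ : Set (Term F × Term F)) : Set (Subst F) :=
  {σ : Subst F | Unifier E Γ σ ∧
    ∀ y ∈ σ.VRan, ∃ x x' : ℕ, x ≠ x' ∧ y ∈ (σ.toFun x).vars ∩ (σ.toFun x').vars}

/-- `E` is Noetherian w.r.t. the unrestricted instantiation preorder: there is
no infinite strictly descending chain `σ₁ >_E^V σ₂ >_E^V ⋯`. -/
def Noetherian (E : Set (Term F × Term F)) : Prop :=
  ¬ ∃ f : ℕ → Subst F, ∀ n : ℕ, InstLT E Set.univ (f (n + 1)) (f n)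


/-- The signature of `EL`: a binary conjunction `⊓`, a constant `⊤`, and a
unary existential restriction `∃r.` for each role name `r : R`. -/
inductive SigEL (R : Type) : ℕ → Type
  | inf : SigEL R 2
  | top : SigEL R 0
  | ex : R → SigEL R 1

variable {R : Type}

/-- The term `s ⊓ t`. -/
def infT (s t : Term (SigEL R)) : Term (SigEL R) := Term.app 2 SigEL.inf ![s, t]

/-- The term `⊤`. -/
def topT : Term (SigEL R) := Term.app 0 SigEL.top ![]

/-- The term `∃r.s`. -/
def exT (r : R) (s : Term (SigEL R)) : Term (SigEL R) := Term.app 1 (SigEL.ex r) ![s]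

/-- The equational theory `EL` (= `bSLmO`): `⊓` is associative, commutative and
idempotent with unit `⊤`, and each `∃r.` is a monotone operator. -/
def ELTheory (R : Type) : Set (Term (SigEL R) × Term (SigEL R)) :=
  {(infT (.var 0) (.var 1), infT (.var 1) (.var 0)),
   (infT (infT (.var 0) (.var 1)) (.var 2), infT (.var 0) (infT (.var 1) (.var 2))),
   (infT (.var 0) (.var 0), .var 0),
   (infT (.var 0) topT, .var 0)} ∪
  {q | ∃ r : R, q = (infT (exT r (.var 0)) (exT r (infT (.var 0) (.var 1))),
                     exT r (infT (.var 0) (.var 1)))}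

/-- The role depth of an `EL` term: maximal nesting of existential
restrictions. -/
def roleDepth : Term (SigEL R) → ℕ
  | .var _ => 0
  | .app _ SigEL.top _ => 0
  | .app _ SigEL.inf ts => max (roleDepth (ts 0)) (roleDepth (ts 1))
  | .app _ (SigEL.ex _) ts => 1 + roleDepth (ts 0)

/-- The set of role names occurring in an `EL` term. -/
def roleNames : Term (SigEL R) → Set R
  | .var _ => ∅
  | .app _ SigEL.top _ => ∅
  | .app _ SigEL.inf ts => roleNames (ts 0) ∪ roleNames (ts 1)
  | .app _ (SigEL.ex r) ts => insert r (roleNames (ts 0))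

/-- Role depth and role names do not decrease under substitution. -/
theorem roleDepth_le_subst_and_roleNames_subset_subst (τ : ℕ → Term (SigEL R))
    (t : Term (SigEL R)) :
    roleDepth t ≤ roleDepth (t.subst τ) ∧ roleNames t ⊆ roleNames (t.subst τ) := by
  induction t with
  | var x => simp [roleDepth, roleNames]
  | app n f ts ih =>
    cases f with
    | top => simp [roleDepth, roleNames, Term.subst]
    | inf =>
      exact ⟨max_le_max (ih 0).1 (ih 1).1, Set.union_subset_union (ih 0).2 (ih 1).2⟩
    | ex r =>
      exact ⟨Nat.add_le_add_left (ih 0).1 1, Set.insert_subset_insert (ih 0).2⟩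

/-- Role depth and role names are invariant under `EL`-equivalence. -/
theorem EqE.roleDepth_eq_and_roleNames_eq {s t : Term (SigEL R)}
    (h : EqE (ELTheory R) s t) :
    roleDepth s = roleDepth t ∧ roleNames s = roleNames t := by
  induction h with
  | ax τ h =>
    simp only [ELTheory, Set.mem_union, Set.mem_insert_iff, Set.mem_singleton_iff,
      Set.mem_ofPred_eq, Prod.mk.injEq] at h
    rcases h with (⟨rfl, rfl⟩ | ⟨rfl, rfl⟩ | ⟨rfl, rfl⟩ | ⟨rfl, rfl⟩) | ⟨r, rfl, rfl⟩ <;>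
      constructor <;>
      simp [infT, topT, exT, Term.subst, roleDepth, roleNames]
    all_goals first | omega | grind
  | refl t => exact ⟨rfl, rfl⟩
  | symm _ ih => exact ⟨ih.1.symm, ih.2.symm⟩
  | trans _ _ ih₁ ih₂ => exact ⟨ih₁.1.trans ih₂.1, ih₁.2.trans ih₂.2⟩
  | congr f _ ih =>
    cases f with
    | top => exact ⟨rfl, rfl⟩
    | inf => simp [roleDepth, roleNames, ih]
    | ex r => simp [roleDepth, roleNames, ih]

/-- Lemma `bounds:lem`: if `σ ≤_EL^V θ`, then for all
variables `x`, the role depth of `σ(x)` is bounded by the role depth of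
`θ(x)`, and all role names of `σ(x)` occur in `θ(x)`. -/
theorem stmt16 {R : Type} [Fintype R] [Nonempty R] (σ θ : Subst (SigEL R))
    (h : InstLE (ELTheory R) Set.univ σ θ) :
    ∀ x : ℕ, roleDepth (σ.toFun x) ≤ roleDepth (θ.toFun x) ∧
      roleNames (σ.toFun x) ⊆ roleNames (θ.toFun x) := by
  obtain ⟨lam, hlam⟩ := h
  intro x
  have hs := roleDepth_le_subst_and_roleNames_subset_subst lam.toFun (σ.toFun x)
  have he := (hlam x (Set.mem_univ x)).roleDepth_eq_and_roleNames_eq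
  exact ⟨hs.1.trans_eq he.1, hs.2.trans he.2.subset⟩
end UnifFW
end

section
/- The unrestricted unification type of the equational theories AI, ACI, and ACUI for elementary unification is infinitary: for each E ∈ {AI, ACI, ACUI}, every solvable elementary E-unification problem has a minimal complete set of E-unifiers w.r.t. the unrestricted instantiation preorder ≤_E^V, and there exists a solvable elementary E-unification problem that has an infinite minimal complete set of E-unifiers w.r.t. ≤_E^V but no finite one. -/
namespace UnifFW

variable {F : ℕ → Type}

/-- The unrestricted unification type of `E` (for elementary unification) is
infinitary: every solvable problem has a minimal complete set of unifiers
w.r.t. `≤_E^V`, and some solvable problem has an infinite minimal complete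
set w.r.t. `≤_E^V` but no finite one. -/
def UnrestrictedTypeInfinitary {F : ℕ → Type} (E : Set (Term F × Term F)) : Prop :=
  (∀ Γ : Set (Term F × Term F), Γ.Finite → Solvable E Γ →
    ∃ S : Set (Subst F), MinimalComplete E Γ Set.univ S) ∧
  (∃ Γ : Set (Term F × Term F), Γ.Finite ∧ Solvable E Γ ∧
    (∃ S : Set (Subst F), S.Infinite ∧ MinimalComplete E Γ Set.univ S) ∧
    ¬ ∃ S : Set (Subst F), S.Finite ∧ MinimalComplete E Γ Set.univ S)

/-- Signature with a single binary function symbol `f`. -/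
inductive SigF : ℕ → Type
  | f : SigF 2

/-- Signature with a binary function symbol `f` and a constant `0`. -/
inductive SigFU : ℕ → Type
  | f : SigFU 2
  | zero : SigFU 0

/-- The term `f(s,t)` over `SigF`. -/
def fT (s t : Term SigF) : Term SigF := Term.app 2 SigF.f ![s, t]

/-- The term `f(s,t)` over `SigFU`. -/
def fU (s t : Term SigFU) : Term SigFU := Term.app 2 SigFU.f ![s, t]

/-- The constant term `0` over `SigFU`. -/
def zeroT : Term SigFU := Term.app 0 SigFU.zero ![]

/-- The theory `AI = A ∪ I`: `f` is associative and idempotent. -/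
def AITheory : Set (Term SigF × Term SigF) :=
  {(fT (.var 0) (fT (.var 1) (.var 2)), fT (fT (.var 0) (.var 1)) (.var 2)),
   (fT (.var 0) (.var 0), .var 0)}

/-- The theory `ACI = A ∪ C ∪ I`: `f` is associative, commutative and
idempotent. -/
def ACITheory : Set (Term SigF × Term SigF) :=
  {(fT (.var 0) (fT (.var 1) (.var 2)), fT (fT (.var 0) (.var 1)) (.var 2)),
   (fT (.var 0) (.var 1), fT (.var 1) (.var 0)),
   (fT (.var 0) (.var 0), .var 0)}

/-- The theory `ACUI = A ∪ C ∪ U ∪ I`: `f` is associative, commutative and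
idempotent with unit `0`. -/
def ACUITheory : Set (Term SigFU × Term SigFU) :=
  {(fU (.var 0) (fU (.var 1) (.var 2)), fU (fU (.var 0) (.var 1)) (.var 2)),
   (fU (.var 0) (.var 1), fU (.var 1) (.var 0)),
   (fU (.var 0) zeroT, .var 0),
   (fU (.var 0) (.var 0), .var 0)}

/-! ### Terms, substitutions and the instantiation preorder -/

theorem Term.vars_finite (t : Term F) : t.vars.Finite := by
  induction t with
  | var x => exact Set.finite_singleton x
  | app n f ts ih => exact Set.finite_iUnion ih

theorem Term.mem_vars_subst {σ : ℕ → Term F} {t : Term F} {x : ℕ} :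
    x ∈ (t.subst σ).vars ↔ ∃ y ∈ t.vars, x ∈ (σ y).vars := by
  induction t with
  | var z => simp [Term.subst, Term.vars]
  | app n f ts ih =>
    simp only [Term.subst, Term.vars, Set.mem_iUnion, ih]
    constructor
    · rintro ⟨i, y, hy, hx⟩
      exact ⟨y, ⟨i, hy⟩, hx⟩
    · rintro ⟨y, ⟨i, hy⟩, hx⟩
      exact ⟨i, y, hy, hx⟩

theorem Term.subst_subst (σ τ : ℕ → Term F) (t : Term F) :
    (t.subst σ).subst τ = t.subst (fun x => (σ x).subst τ) := by
  induction t with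
  | var z => rfl
  | app n f ts ih => simp only [Term.subst, ih]

theorem Term.subst_congr {σ τ : ℕ → Term F} {t : Term F} (h : ∀ x ∈ t.vars, σ x = τ x) :
    t.subst σ = t.subst τ := by
  induction t with
  | var z => exact h z rfl
  | app n f ts ih =>
    simp only [Term.subst]
    congr 1
    funext i
    exact ih i fun x hx => h x (Set.mem_iUnion.2 ⟨i, hx⟩)

theorem Term.subst_var (t : Term F) : t.subst Term.var = t := by
  induction t with
  | var z => rfl
  | app n f ts ih => simp only [Term.subst, ih]

theorem Term.subst_eq_self {σ : ℕ → Term F} {t : Term F}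
    (h : ∀ x ∈ t.vars, σ x = .var x) : t.subst σ = t :=
  (Term.subst_congr h).trans t.subst_var

theorem EqE.of_eq {E : Set (Term F × Term F)} {s t : Term F} (h : s = t) : EqE E s t :=
  h ▸ EqE.refl s

theorem EqE.subst {E : Set (Term F × Term F)} {s t : Term F} (h : EqE E s t)
    (τ : ℕ → Term F) : EqE E (s.subst τ) (t.subst τ) := by
  induction h with
  | ax σ hst =>
    rw [Term.subst_subst, Term.subst_subst]
    exact EqE.ax _ hst
  | refl t => exact EqE.refl _
  | symm _ ih => exact ih.symm
  | trans _ _ ih₁ ih₂ => exact ih₁.trans ih₂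
  | congr f _ ih => exact EqE.congr f ih

theorem EqE.vars_eq {E : Set (Term F × Term F)} (hE : Regular E) {s t : Term F}
    (h : EqE E s t) : s.vars = t.vars := by
  induction h with
  | @ax s t σ hst =>
    ext x
    have : s.vars = t.vars := hE _ hst
    rw [Term.mem_vars_subst, Term.mem_vars_subst, this]
  | refl t => rfl
  | symm _ ih => exact ih.symm
  | trans _ _ ih₁ ih₂ => exact ih₁.trans ih₂
  | congr f _ ih => simp only [Term.vars, ih]

/-- The composition `x ↦ λ(σ(x))`. -/
def Subst.comp (lam σ : Subst F) : Subst F where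
  toFun x := (σ.toFun x).subst lam.toFun
  finite_dom := by
    refine (σ.finite_dom.union lam.finite_dom).subset fun x hx => ?_
    by_contra h
    simp only [Set.mem_union, Set.mem_ofPred_eq, not_or, not_not] at h
    exact hx (by rw [h.1]; exact h.2)

/-- The identity substitution. -/
def Subst.id : Subst F where
  toFun := .var
  finite_dom := by simp

/-- The substitution `x ↦ σ(π(x))` for a finitely supported permutation `π`. -/
def Subst.precomp (σ : Subst F) (π : Equiv.Perm ℕ) (h : {x | π x ≠ x}.Finite) : Subst F where
  toFun x := σ.toFun (π x)
  finite_dom := by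
    refine (σ.finite_dom.union h).subset fun x hx => ?_
    by_contra h
    simp only [Set.mem_union, Set.mem_ofPred_eq, not_or, not_not] at h
    exact hx (by rw [h.2, h.1])

theorem InstLE.refl (E : Set (Term F × Term F)) (X : Set ℕ) (σ : Subst F) : InstLE E X σ σ :=
  ⟨Subst.id, fun _ _ => EqE.of_eq (Term.subst_var _)⟩

theorem InstLE.trans {E : Set (Term F × Term F)} {X : Set ℕ} {σ τ θ : Subst F}
    (h₁ : InstLE E X σ τ) (h₂ : InstLE E X τ θ) : InstLE E X σ θ := by
  obtain ⟨l₁, h₁⟩ := h₁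
  obtain ⟨l₂, h₂⟩ := h₂
  refine ⟨l₂.comp l₁, fun x hx => ?_⟩
  have := (h₁ x hx).subst l₂.toFun
  rw [Term.subst_subst] at this
  exact this.trans (h₂ x hx)

theorem InstLE.precomp {E : Set (Term F × Term F)} {σ τ : Subst F}
    (h : InstLE E Set.univ σ τ) (π : Equiv.Perm ℕ) (hπ : {x | π x ≠ x}.Finite) :
    InstLE E Set.univ (σ.precomp π hπ) (τ.precomp π hπ) := by
  obtain ⟨l, h⟩ := h
  exact ⟨l, fun x _ => h (π x) trivial⟩

theorem Unifier.of_instLE {E Γ : Set (Term F × Term F)} {σ θ : Subst F}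
    (hσ : Unifier E Γ σ) (h : InstLE E Set.univ σ θ) : Unifier E Γ θ := by
  obtain ⟨l, h⟩ := h
  have key : ∀ t : Term F, EqE E ((t.subst σ.toFun).subst l.toFun) (t.subst θ.toFun) := by
    intro t
    induction t with
    | var x => exact h x trivial
    | app n f ts ih => exact EqE.congr f ih
  intro p hp
  exact (key _).symm.trans (((hσ p hp).subst l.toFun).trans (key _))

theorem Noetherian.exists_minimalComplete {E : Set (Term F × Term F)} (hE : Noetherian E)
    (Γ : Set (Term F × Term F)) : ∃ S, MinimalComplete E Γ Set.univ S := by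
  have wf : WellFounded (InstLT E Set.univ) := by
    rw [wellFounded_iff_isEmpty_descending_chain]
    exact ⟨fun f => hE ⟨f.1, f.2⟩⟩
  let M : Set (Subst F) := {σ | MinUnifier E Γ Set.univ σ}
  let s : Setoid (Subst F) :=
    { r := InstEquiv E Set.univ
      iseqv := ⟨fun σ => ⟨.refl _ _ _, .refl _ _ _⟩, fun h => ⟨h.2, h.1⟩,
        fun h₁ h₂ => ⟨h₁.1.trans h₂.1, h₂.2.trans h₁.2⟩⟩ }
  let rep : Subst F → Subst F := fun σ => (Quotient.mk s σ).out
  have hrep : ∀ σ, InstEquiv E Set.univ (rep σ) σ := fun σ => Quotient.mk_out (s := s) σ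
  refine ⟨rep '' M, ⟨?_, ?_⟩, ?_⟩
  · rintro _ ⟨σ, hσ, rfl⟩
    exact hσ.1.of_instLE (hrep σ).2
  · intro θ hθ
    obtain ⟨σ, ⟨hσ, hσθ⟩, hmin⟩ := wf.has_min
      {σ | Unifier E Γ σ ∧ InstLE E Set.univ σ θ} ⟨θ, hθ, .refl _ _ _⟩
    refine ⟨rep σ, ⟨σ, ⟨hσ, fun τ hτ hle => ?_⟩, rfl⟩, (hrep σ).1.trans hσθ⟩
    by_contra hn
    exact hmin τ ⟨hτ, hle.trans hσθ⟩ ⟨hle, hn⟩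
  · rintro _ ⟨σ, hσ, rfl⟩ _ ⟨θ, hθ, rfl⟩ hne hle
    refine hne (congrArg Quotient.out (Quotient.sound (s := s) ?_))
    have h : InstLE E Set.univ σ θ := ((hrep σ).2.trans hle).trans (hrep θ).1
    exact ⟨h, hθ.2 σ hσ.1 h⟩

/-! ### Bands -/

section Band

variable {S : Type*} [Semigroup S]

theorem band_sandwich (h : ∀ x : S, x * x = x) {x s g t : S} (hx : x = s * g * t) :
    x * g * x = x := by
  have hk : s * g * x = x := by
    conv_rhs => rw [hx, ← h (s * g)]
    rw [hx, mul_assoc]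
    simp only [mul_assoc]
  have hm : x * (g * t) = x := by
    conv_rhs => rw [hx, mul_assoc, ← h (g * t)]
    rw [hx]
    simp only [mul_assoc]
  have hr : x * (g * t * (s * g)) * x = x := by
    calc x * (g * t * (s * g)) * x = (x * (g * t)) * (s * g * x) := by simp only [mul_assoc]
      _ = x := by rw [hk, hm, h]
  calc x * g * x = (x * (g * t * (s * g)) * x) * g * x := by rw [hr]
    _ = x * (g * t * s) * ((g * x) * (g * x)) := by simp only [mul_assoc]
    _ = x * (g * t * (s * g)) * x := by rw [h (g * x)]; simp only [mul_assoc]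
    _ = x := hr

theorem band_sandwich_mul (h : ∀ x : S, x * x = x) {x a b : S} (ha : x * a * x = x)
    (hb : x * b * x = x) : x * (a * b) * x = x := by
  have key : x = (x * a * x * b) * (a * b) * (a * x * b * x) := by
    calc x = (x * a * x) * b * x := by rw [ha, hb]
      _ = x * (a * x * b) * x := by simp only [mul_assoc]
      _ = x * ((a * x * b) * (a * x * b)) * x := by rw [h]
      _ = (x * a * x) * (b * a) * (x * b * x) := by simp only [mul_assoc]
      _ = (x * a * x) * ((b * a) * (b * a)) * (x * b * x) := by rw [h (b * a)]
      _ = (x * a * x * b) * a * b * a * (x * b * x) := by simp only [mul_assoc]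
      _ = (x * a * x * b) * (a * b) * (a * x * b * x) := by simp only [mul_assoc]
  exact band_sandwich h key

theorem band_mul_eq {w e f : S} (hew : e * w = w) (hwf : w * f = w)
    (he : e * w * e = e) (hf : f * w * f = f) (hw : w * (e * f) * w = w) : e * f = w := by
  have he' : w * e = e := by rw [← hew, he]
  have hf' : f * w = f := by
    calc f * w = f * (w * f) := by rw [hwf]
      _ = f := by rw [← mul_assoc, hf]
  calc e * f = w * (e * f) * w := by rw [mul_assoc, mul_assoc, hf', ← mul_assoc, he']
    _ = w := hw

/-- The value of a term over `SigF` in a semigroup. -/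
def interp (ν : ℕ → S) : Term SigF → S
  | .var x => ν x
  | .app _ .f ts => interp ν (ts 0) * interp ν (ts 1)

theorem fT_induction {P : Term SigF → Prop} (hv : ∀ x, P (.var x))
    (hm : ∀ s t, P s → P t → P (fT s t)) (t : Term SigF) : P t := by
  induction t with
  | var x => exact hv x
  | app n g ts ih =>
    cases g
    have : ts = ![ts 0, ts 1] := by
      funext i
      fin_cases i <;> rfl
    rw [this]
    exact hm _ _ (ih 0) (ih 1)

theorem vars_app_two {b : F 2} (s t : Term F) :
    (Term.app 2 b ![s, t]).vars = s.vars ∪ t.vars := by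
  ext x
  simp [Term.vars, Fin.exists_fin_two]

theorem subst_app_two {b : F 2} (s t : Term F) (σ : ℕ → Term F) :
    (Term.app 2 b ![s, t]).subst σ = Term.app 2 b ![s.subst σ, t.subst σ] := by
  simp only [Term.subst]
  congr 1
  funext i
  fin_cases i <;> rfl

theorem vars_fT (s t : Term SigF) : (fT s t).vars = s.vars ∪ t.vars := vars_app_two s t

theorem vars_nonempty (t : Term SigF) : t.vars.Nonempty := by
  induction t using fT_induction with
  | hv x => exact ⟨x, rfl⟩
  | hm s t hs _ => rw [vars_fT]; exact hs.inl

variable (ν : ℕ → S)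

theorem interp_fT (s t : Term SigF) : interp ν (fT s t) = interp ν s * interp ν t := rfl

variable {ν}

theorem interp_sandwich (h : ∀ x : S, x * x = x) {x t : Term SigF} (ht : t.vars ⊆ x.vars) :
    interp ν x * interp ν t * interp ν x = interp ν x := by
  induction t using fT_induction with
  | hm s t hs ht' =>
    rw [vars_fT, Set.union_subset_iff] at ht
    exact band_sandwich_mul h (hs ht.1) (ht' ht.2)
  | hv a =>
    have ha : a ∈ x.vars := ht rfl
    clear ht
    induction x using fT_induction with
    | hv b =>
      obtain rfl : a = b := ha
      simp only [interp, h]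
    | hm s t hs ht =>
      rw [vars_fT] at ha
      rcases ha with ha | ha
      · refine band_sandwich h (s := interp ν s) (t := interp ν s * interp ν t) ?_
        rw [interp_fT, ← mul_assoc, hs ha]
      · refine band_sandwich h (s := interp ν s * interp ν t) (t := interp ν t) ?_
        conv_lhs => rw [interp_fT, ← ht ha]
        simp only [mul_assoc]

theorem exists_prefix_of_mul (h : ∀ x : S, x * x = x) (u s : Term SigF) :
    u.vars ⊆ s.vars ∨ ∃ p a, (fT p (.var a)).vars = (fT s u).vars ∧ p.vars ⊂ (fT s u).vars ∧
      interp ν (fT p (.var a)) * interp ν (fT s u) = interp ν (fT s u) := by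
  induction u using fT_induction generalizing s with
  | hv a =>
    by_cases ha : a ∈ s.vars
    · exact .inl (by simpa [Term.vars] using ha)
    · refine .inr ⟨s, a, rfl, ?_, h _⟩
      rw [vars_fT]
      exact ⟨Set.subset_union_left, fun hs => ha (hs (.inr rfl))⟩
  | hm u₁ u₂ ih₁ ih₂ =>
    have e : (fT s (fT u₁ u₂)).vars = (fT (fT s u₁) u₂).vars := by
      simp only [vars_fT, Set.union_assoc]
    have e' : interp ν (fT s (fT u₁ u₂)) = interp ν (fT (fT s u₁) u₂) := by
      simp only [interp_fT, mul_assoc]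
    rcases ih₂ (fT s u₁) with h₂ | ⟨p, a, hp⟩
    · have e₂ : (fT (fT s u₁) u₂).vars = (fT s u₁).vars := by
        rw [vars_fT, Set.union_eq_left.2 h₂]
      rcases ih₁ s with h₁ | ⟨p, a, hp, hps, hpi⟩
      · left
        rw [vars_fT, Set.union_eq_left.2 h₁] at h₂
        rw [vars_fT]
        exact Set.union_subset h₁ h₂
      · refine .inr ⟨p, a, ?_⟩
        rw [e, e', e₂, interp_fT ν (fT s u₁), ← mul_assoc, hpi]
        exact ⟨hp, hps, rfl⟩
    · exact .inr ⟨p, a, by rw [e, e']; exact hp⟩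

theorem exists_prefix (h : ∀ x : S, x * x = x) (t : Term SigF) :
    ∃ e : Term SigF, e.vars = t.vars ∧ interp ν e * interp ν t = interp ν t ∧
      ((∃ a, e = .var a) ∨ ∃ p a, p.vars ⊂ t.vars ∧ e = fT p (.var a)) := by
  induction t using fT_induction with
  | hv a => exact ⟨.var a, rfl, h _, .inl ⟨a, rfl⟩⟩
  | hm s u ihs _ =>
    rcases exists_prefix_of_mul (ν := ν) h u s with hu | ⟨p, a, hp, hps, hpi⟩
    · obtain ⟨e, he, hei, hor⟩ := ihs
      have : (fT s u).vars = s.vars := by rw [vars_fT, Set.union_eq_left.2 hu]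
      refine ⟨e, ?_, ?_, ?_⟩
      · rw [this, he]
      · rw [interp_fT, ← mul_assoc, hei]
      · rwa [this]
    · exact ⟨_, hp, hpi, .inr ⟨p, a, hps, rfl⟩⟩

theorem exists_suffix_of_mul (h : ∀ x : S, x * x = x) (u s : Term SigF) :
    u.vars ⊆ s.vars ∨ ∃ p a, (fT (.var a) p).vars = (fT u s).vars ∧ p.vars ⊂ (fT u s).vars ∧
      interp ν (fT u s) * interp ν (fT (.var a) p) = interp ν (fT u s) := by
  induction u using fT_induction generalizing s with
  | hv a =>
    by_cases ha : a ∈ s.vars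
    · exact .inl (by simpa [Term.vars] using ha)
    · refine .inr ⟨s, a, rfl, ?_, h _⟩
      rw [vars_fT]
      exact ⟨Set.subset_union_right, fun hs => ha (hs (.inl rfl))⟩
  | hm u₁ u₂ ih₁ ih₂ =>
    have e : (fT (fT u₁ u₂) s).vars = (fT u₁ (fT u₂ s)).vars := by
      simp only [vars_fT, Set.union_assoc]
    have e' : interp ν (fT (fT u₁ u₂) s) = interp ν (fT u₁ (fT u₂ s)) := by
      simp only [interp_fT, mul_assoc]
    rcases ih₁ (fT u₂ s) with h₁ | ⟨p, a, hp⟩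
    · have e₂ : (fT u₁ (fT u₂ s)).vars = (fT u₂ s).vars := by
        rw [vars_fT, Set.union_eq_right.2 h₁]
      rcases ih₂ s with h₂ | ⟨p, a, hp, hps, hpi⟩
      · left
        rw [vars_fT, Set.union_eq_right.2 h₂] at h₁
        rw [vars_fT]
        exact Set.union_subset h₁ h₂
      · refine .inr ⟨p, a, ?_⟩
        rw [e, e', e₂, interp_fT ν u₁, mul_assoc, hpi]
        exact ⟨hp, hps, rfl⟩
    · exact .inr ⟨p, a, by rw [e, e']; exact hp⟩

theorem exists_suffix (h : ∀ x : S, x * x = x) (t : Term SigF) :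
    ∃ e : Term SigF, e.vars = t.vars ∧ interp ν t * interp ν e = interp ν t ∧
      ((∃ a, e = .var a) ∨ ∃ p a, p.vars ⊂ t.vars ∧ e = fT (.var a) p) := by
  induction t using fT_induction with
  | hv a => exact ⟨.var a, rfl, h _, .inl ⟨a, rfl⟩⟩
  | hm s u _ ihu =>
    rcases exists_suffix_of_mul (ν := ν) h s u with hs | ⟨p, a, hp, hps, hpi⟩
    · obtain ⟨e, he, hei, hor⟩ := ihu
      have : (fT s u).vars = u.vars := by rw [vars_fT, Set.union_eq_right.2 hs]
      refine ⟨e, ?_, ?_, ?_⟩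
      · rw [this, he]
      · rw [interp_fT, mul_assoc, hei]
      · rwa [this]
    · exact ⟨_, hp, hpi, .inr ⟨p, a, hps, rfl⟩⟩

/-- Finitely generated bands are finite. -/
theorem exists_finite_representatives (h : ∀ x : S, x * x = x) (ν : ℕ → S) {X : Set ℕ}
    (hX : X.Finite) :
    ∃ R : Set (Term SigF), R.Finite ∧ ∀ t : Term SigF, t.vars ⊆ X →
      ∃ r ∈ R, interp ν t = interp ν r := by
  suffices H : ∀ n : ℕ, ∃ R : Set (Term SigF), R.Finite ∧ ∀ t : Term SigF, t.vars ⊆ X →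
      t.vars.ncard ≤ n → ∃ r ∈ R, interp ν t = interp ν r by
    obtain ⟨R, hR, hRt⟩ := H X.ncard
    exact ⟨R, hR, fun t ht => hRt t ht (Set.ncard_le_ncard ht hX)⟩
  intro n
  induction n with
  | zero =>
    refine ⟨∅, Set.finite_empty, fun t _ h0 => ?_⟩
    have := (Set.ncard_pos t.vars_finite).2 (vars_nonempty t)
    omega
  | succ n ih =>
    obtain ⟨R, hR, hRt⟩ := ih
    let V : Set (Term SigF) := Term.var '' X
    have hV : V.Finite := hX.image _
    refine ⟨Set.image2 fT (V ∪ Set.image2 fT R V) (V ∪ Set.image2 fT V R),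
      (hV.union (hR.image2 _ hV)).image2 _ (hV.union (hV.image2 _ hR)), fun t ht hn => ?_⟩
    obtain ⟨e, he, hei, heor⟩ := exists_prefix (ν := ν) h t
    obtain ⟨f₀, hf, hfi, hfor⟩ := exists_suffix (ν := ν) h t
    have hsmall : ∀ p : Term SigF, p.vars ⊂ t.vars → ∃ r ∈ R, interp ν p = interp ν r := by
      intro p hp
      refine hRt p (hp.subset.trans ht) ?_
      have := Set.ncard_lt_ncard hp t.vars_finite
      omega
    have hE : ∃ e' ∈ V ∪ Set.image2 fT R V, interp ν e = interp ν e' := by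
      rcases heor with ⟨a, rfl⟩ | ⟨p, a, hp, rfl⟩
      · exact ⟨_, .inl ⟨a, ht (he ▸ rfl), rfl⟩, rfl⟩
      · obtain ⟨r, hr, hpr⟩ := hsmall p hp
        refine ⟨fT r (.var a), .inr ⟨r, hr, _, ⟨a, ht ?_, rfl⟩, rfl⟩, ?_⟩
        · rw [← he, vars_fT]
          exact .inr rfl
        · rw [interp_fT, interp_fT, hpr]
    have hF : ∃ f' ∈ V ∪ Set.image2 fT V R, interp ν f₀ = interp ν f' := by
      rcases hfor with ⟨a, rfl⟩ | ⟨p, a, hp, rfl⟩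
      · exact ⟨_, .inl ⟨a, ht (hf ▸ rfl), rfl⟩, rfl⟩
      · obtain ⟨r, hr, hpr⟩ := hsmall p hp
        refine ⟨fT (.var a) r, .inr ⟨_, ⟨a, ht ?_, rfl⟩, r, hr, rfl⟩, ?_⟩
        · rw [← hf, vars_fT]
          exact .inl rfl
        · rw [interp_fT, interp_fT, hpr]
    obtain ⟨e', he', hee'⟩ := hE
    obtain ⟨f', hf', hff'⟩ := hF
    refine ⟨fT e' f', ⟨e', he', f', hf', rfl⟩, ?_⟩
    rw [interp_fT, ← hee', ← hff']
    refine (band_mul_eq hei hfi (interp_sandwich h he.ge) (interp_sandwich h hf.ge) ?_).symm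
    refine interp_sandwich h (t := fT e f₀) ?_
    rw [vars_fT, he, hf, Set.union_self]

end Band

/-! ### Theories with a band operation -/

/-- The binary symbol `b` is associative and idempotent modulo `E`. -/
def IsBandOp (E : Set (Term F × Term F)) (b : F 2) : Prop :=
  (∀ s t u, EqE E (.app 2 b ![s, .app 2 b ![t, u]]) (.app 2 b ![.app 2 b ![s, t], u])) ∧
    ∀ s, EqE E (.app 2 b ![s, s]) s

theorem EqE.app_two {E : Set (Term F × Term F)} (b : F 2) {s s' t t' : Term F}
    (hs : EqE E s s') (ht : EqE E t t') : EqE E (.app 2 b ![s, t]) (.app 2 b ![s', t']) := by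
  refine EqE.congr b fun i => ?_
  fin_cases i
  exacts [hs, ht]

/-- Equality modulo `E` as a setoid. -/
@[reducible] def eqSetoid (E : Set (Term F × Term F)) : Setoid (Term F) where
  r := EqE E
  iseqv := ⟨EqE.refl, EqE.symm, EqE.trans⟩

/-- The semigroup structure on terms modulo `E` given by a band operation. -/
@[reducible] def quotientSemigroup {E : Set (Term F × Term F)} {b : F 2} (hb : IsBandOp E b) :
    Semigroup (Quotient (eqSetoid E)) where
  mul := Quotient.map₂ (fun s t => .app 2 b ![s, t])
    (fun _ _ hs _ _ ht => EqE.app_two b hs ht)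
  mul_assoc := by
    rintro ⟨s⟩ ⟨t⟩ ⟨u⟩
    exact Quotient.sound (hb.1 s t u).symm

/-- The translation of terms over `SigF` interpreting `f` as `b`. -/
def embed (b : F 2) : Term SigF → Term F
  | .var x => .var x
  | .app _ .f ts => .app 2 b ![embed b (ts 0), embed b (ts 1)]

theorem vars_embed (b : F 2) (t : Term SigF) : (embed b t).vars = t.vars := by
  induction t using fT_induction with
  | hv x => rfl
  | hm s t hs ht =>
    rw [vars_fT, ← hs, ← ht]
    exact vars_app_two _ _

section Quotient

variable {E : Set (Term F × Term F)} {b : F 2}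

theorem exists_interp_quotient (hb : IsBandOp E b) :
    ∃ (_ : Semigroup (Quotient (eqSetoid E))) (ν : ℕ → Quotient (eqSetoid E)),
      (∀ x : Quotient (eqSetoid E), x * x = x) ∧
      ∀ s t : Term SigF, EqE E (embed b s) (embed b t) ↔ interp ν s = interp ν t := by
  let := quotientSemigroup hb
  refine ⟨this, fun x => ⟦.var x⟧, ?_, ?_⟩
  · rintro ⟨s⟩
    exact Quotient.sound (hb.2 s)
  · have key : ∀ t : Term SigF,
        interp (fun x => (⟦.var x⟧ : Quotient (eqSetoid E))) t = ⟦embed b t⟧ := by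
      intro t
      induction t using fT_induction with
      | hv x => rfl
      | hm s t hs ht => rw [interp_fT, hs, ht]; rfl
    intro s t
    rw [key, key]
    exact ⟨fun h => Quotient.sound h, fun h => Quotient.exact h⟩

/-- Modulo `E` there are only finitely many terms over a given finite set of variables. -/
def LocallyFinite (E : Set (Term F × Term F)) : Prop :=
  ∀ X : Set ℕ, X.Finite → ∃ R : Set (Term F), R.Finite ∧ ∀ t : Term F, t.vars ⊆ X →
    ∃ r ∈ R, EqE E t r

theorem IsBandOp.locallyFinite (hb : IsBandOp E b) {K : Set (Term F)} (hK : K.Finite)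
    (hgen : ∀ t : Term F, (∃ k ∈ K, EqE E t k) ∨
      ∃ s : Term SigF, s.vars ⊆ t.vars ∧ EqE E t (embed b s)) : LocallyFinite E := by
  intro X hX
  obtain ⟨_, ν, hidem, hν⟩ := exists_interp_quotient hb
  obtain ⟨R, hR, hRt⟩ := exists_finite_representatives hidem ν hX
  refine ⟨K ∪ embed b '' R, hK.union (hR.image _), fun t ht => ?_⟩
  rcases hgen t with ⟨k, hk, htk⟩ | ⟨s, hs, hts⟩
  · exact ⟨k, .inl hk, htk⟩
  · obtain ⟨r, hr, hsr⟩ := hRt s (hs.trans ht)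
    exact ⟨_, .inr ⟨r, hr, rfl⟩, hts.trans ((hν s r).2 hsr)⟩

end Quotient

/-! ### Regular locally finite theories are Noetherian -/

theorem exists_perm_extending {Y A : Set ℕ} (hY : Y.Finite) (hAY : A ⊆ Y) {g : ℕ → ℕ}
    (hg : Set.MapsTo g A Y) (hinj : Set.InjOn g A) :
    ∃ π : Equiv.Perm ℕ, IsOfFinOrder π ∧ (∀ x ∉ Y, π x = x) ∧ ∀ a ∈ A, π a = g a := by
  classical
  lift Y to Finset ℕ using hY
  obtain ⟨e, he⟩ := Set.MapsTo.exists_equiv_extend_of_card_eq (α := Y) (t := Y)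
    (s := {a | (a : ℕ) ∈ A}) (f := fun a => g a) (by simp) (fun a ha => hg ha)
    (fun a ha a' ha' h => Subtype.ext (hinj ha ha' h))
  refine ⟨Equiv.Perm.ofSubtype e, MonoidHom.isOfFinOrder _ (isOfFinOrder_of_finite e),
    fun x hx => Equiv.Perm.ofSubtype_apply_of_not_mem e hx, fun a ha => ?_⟩
  · rw [Equiv.Perm.ofSubtype_apply_of_mem e (hAY ha)]
    exact he ⟨a, hAY ha⟩ ha

/-- On `X` the substitution uses only variables of `X`, and the image of any other variable
contains at most that variable and variables of `X`. -/
def NormalOn (X : Set ℕ) (σ : Subst F) : Prop :=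
  (∀ x ∈ X, (σ.toFun x).vars ⊆ X) ∧ ∀ v ∉ X, (σ.toFun v).vars ⊆ insert v X

theorem perm_symm_support_finite {π : Equiv.Perm ℕ} (h : {x | π x ≠ x}.Finite) :
    {x | π.symm x ≠ x}.Finite := by
  refine h.subset fun x hx hx' => hx ?_
  rw [Equiv.symm_apply_eq, hx']

/-- The variable renaming given by a finitely supported permutation. -/
def permSubst (π : Equiv.Perm ℕ) (h : {x | π x ≠ x}.Finite) : Subst F where
  toFun x := .var (π x)
  finite_dom := h.subset fun x hx hx' => hx (by rw [hx'])

theorem exists_normalOn {E : Set (Term F × Term F)} (hE : Regular E) {X : Set ℕ}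
    (hX : X.Finite) {σ θ : Subst F} (hθ : ∀ v ∉ X, θ.toFun v = .var v)
    (hθX : ∀ x ∈ X, (θ.toFun x).vars ⊆ X) (h : InstLE E Set.univ σ θ) :
    ∃ τ : Subst F, NormalOn X τ ∧ InstEquiv E Set.univ σ τ := by
  obtain ⟨l, hl⟩ := h
  have hvars : ∀ x z, z ∈ (θ.toFun x).vars ↔ ∃ y ∈ (σ.toFun x).vars, z ∈ (l.toFun y).vars := by
    intro x z
    rw [← EqE.vars_eq hE (hl x trivial), Term.mem_vars_subst]
  have hy : ∀ v, ∃ y, v ∉ X → y ∈ (σ.toFun v).vars ∧ (l.toFun y).vars = {v} := by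
    intro v
    by_cases hv : v ∈ X
    · exact ⟨0, fun h => absurd hv h⟩
    obtain ⟨y, hy, hvy⟩ := (hvars v v).1 (by rw [hθ v hv]; rfl)
    refine ⟨y, fun _ => ⟨hy, Set.Subset.antisymm (fun z hz => ?_) (by simpa using hvy)⟩⟩
    have := (hvars v z).2 ⟨y, hy, hz⟩
    rwa [hθ v hv] at this
  choose y hy using hy
  have hyd : ∀ v ∉ X, σ.toFun v = .var v → y v = v := by
    intro v hv hσ
    have := (hy v hv).1
    rw [hσ] at this
    exact this
  have hyinj : Set.InjOn y Xᶜ := by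
    intro v hv w hw hvw
    have h1 := (hy v hv).2
    rw [hvw, (hy w hw).2] at h1
    exact (Set.singleton_injective h1).symm
  let Y := X ∪ {x | σ.toFun x ≠ .var x}
  have hYfin : Y.Finite := hX.union σ.finite_dom
  have hYout : ∀ v ∉ Y, v ∉ X ∧ y v = v := by
    intro v hv
    simp only [Y, Set.mem_union, Set.mem_ofPred_eq, not_or, not_not] at hv
    exact ⟨hv.1, hyd v hv.1 hv.2⟩
  have hmaps : Set.MapsTo y (Y \ X) Y := by
    intro v hv
    by_contra hn
    have h1 := hYout _ hn
    have := hyinj h1.1 hv.2 h1.2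
    rw [this] at hn
    exact hn hv.1
  obtain ⟨π, -, hπY, hπy⟩ := exists_perm_extending hYfin Set.sdiff_subset hmaps
    (hyinj.mono fun v hv => hv.2)
  have hπ : ∀ v ∉ X, π v = y v := by
    intro v hv
    by_cases hvY : v ∈ Y
    · exact hπy v ⟨hvY, hv⟩
    · rw [hπY v hvY, (hYout v hvY).2]
  have hfin : {x | π x ≠ x}.Finite := hYfin.subset fun x hx => by
    by_contra h
    exact hx (hπY x h)
  let τ : Subst F := (permSubst π.symm (perm_symm_support_finite hfin)).comp σ
  have hτ : ∀ x z, z ∈ (τ.toFun x).vars → (l.toFun (π z)).vars ⊆ (θ.toFun x).vars := by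
    intro x z hz w hw
    obtain ⟨u, hu, hzu⟩ := Term.mem_vars_subst.1 hz
    obtain rfl : z = π.symm u := hzu
    rw [Equiv.apply_symm_apply] at hw
    exact (hvars x w).2 ⟨u, hu, hw⟩
  refine ⟨τ, ⟨fun x hx z hz => ?_, fun v hv z hz => ?_⟩,
    ⟨_, fun x _ => EqE.refl _⟩, permSubst π hfin, fun x _ => EqE.of_eq ?_⟩
  · by_contra hzX
    have h1 := hτ x z hz
    rw [hπ z hzX, (hy z hzX).2] at h1
    exact hzX (hθX x hx (h1 rfl))
  · by_contra hn
    rw [Set.mem_insert_iff, not_or] at hn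
    have h1 := hτ v z hz
    rw [hπ z hn.2, (hy z hn.2).2, hθ v hv] at h1
    exact hn.1 (h1 rfl)
  · simp only [τ, Subst.comp]
    rw [Term.subst_subst]
    refine Term.subst_eq_self fun z _ => ?_
    simp [permSubst, Term.subst]

theorem LocallyFinite.exists_precomp_instLE {E : Set (Term F × Term F)} (hE : LocallyFinite E)
    {X : Set ℕ} (hX : X.Finite) {f : ℕ → Subst F} (hf : ∀ n, NormalOn X (f n)) :
    ∃ i j, i < j ∧ ∃ (π : Equiv.Perm ℕ) (hπ : {x | π x ≠ x}.Finite), IsOfFinOrder π ∧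
      InstLE E Set.univ ((f i).precomp π hπ) (f j) := by
  classical
  obtain ⟨s, hs⟩ := hX.exists_notMem
  obtain ⟨R, hR, hRt⟩ := hE (insert s X) (hX.insert s)
  have := hR.to_subtype
  have := hX.to_subtype
  let c : Term F → Set R := fun t => {r | EqE E t r}
  have hc : ∀ t t', t.vars ⊆ insert s X → c t = c t' → EqE E t t' := by
    intro t t' ht h
    obtain ⟨r, hr, htr⟩ := hRt t ht
    have h1 : (⟨r, hr⟩ : R) ∈ c t' := h ▸ htr
    exact htr.trans (EqE.symm h1)
  -- The class of the image of `v`, with `v` renamed to the fixed variable `s`.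
  let col : ℕ → ℕ → Set R := fun n v =>
    c (((f n).toFun v).subst fun x => .var (Equiv.swap v s x))
  let q₀ : Set R := c (.var s)
  have hswap : ∀ v ∉ X, ∀ x ∈ X, Equiv.swap v s x = x := fun v hv x hx =>
    Equiv.swap_apply_of_ne_of_ne (fun h => hv (h ▸ hx)) (fun h => hs (h ▸ hx))
  have hvars : ∀ n, ∀ v ∉ X,
      (((f n).toFun v).subst fun x => .var (Equiv.swap v s x)).vars ⊆ insert s X := by
    intro n v hv z hz
    obtain ⟨y, hy, hzy⟩ := Term.mem_vars_subst.1 hz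
    obtain rfl : z = Equiv.swap v s y := hzy
    rcases (hf n).2 v hv hy with rfl | hyX
    · simp
    · rw [hswap v hv y hyX]
      exact .inr hyX
  have hcol : ∀ i j, ∀ u ∉ X, ∀ v ∉ X, col i u = col j v → ∀ ρ : ℕ → Term F,
      (∀ x ∈ X, ρ x = .var x) → ρ u = .var v →
      EqE E (((f i).toFun u).subst ρ) ((f j).toFun v) := by
    intro i j u hu v hv h ρ hρ hρu
    have h1 := (hc _ _ (hvars i u hu) h).subst fun x => .var (Equiv.swap v s x)
    rw [Term.subst_subst, Term.subst_subst] at h1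
    refine ((EqE.of_eq (Term.subst_congr fun x hx => ?_)).trans h1).trans
      (EqE.of_eq (Term.subst_eq_self fun x _ => ?_))
    · rcases (hf i).2 u hu hx with rfl | hxX
      · simp [Term.subst, hρu]
      · simp [Term.subst, hρ x hxX, hswap u hu x hxX, hswap v hv x hxX]
    · simp [Term.subst]
  have hcol₀ : ∀ n, ∀ v ∉ X, col n v = q₀ → EqE E ((f n).toFun v) (.var v) := by
    intro n v hv h
    have h1 := (hc _ _ (hvars n v hv) h).subst fun x => .var (Equiv.swap v s x)
    rw [Term.subst_subst] at h1
    refine ((EqE.of_eq (Term.subst_eq_self fun x _ => ?_)).symm.trans h1).trans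
      (EqE.of_eq ?_)
    · simp [Term.subst]
    · simp [Term.subst]
  let D : ℕ → Set R → Set ℕ := fun n q => {v | v ∉ X ∧ col n v = q}
  let B : ℕ → Set ℕ := fun n => {v | v ∉ X ∧ col n v ≠ q₀}
  have hB : ∀ n, (B n).Finite := by
    intro n
    refine (f n).finite_dom.subset fun v hv h => hv.2 ?_
    simp [col, q₀, h, Term.subst]
  obtain ⟨i, j, hij, hshape, hcard⟩ := (WellQuasiOrdered.prod
    (Finite.wellQuasiOrdered (α := X → Set R) (· = ·))
    (wellQuasiOrdered_le (α := Set R → ℕ)))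
    fun n => (fun x => c ((f n).toFun x), fun q => (D n q).ncard)
  have hDfin : ∀ n q, q ≠ q₀ → (D n q).Finite := fun n q hq =>
    (hB n).subset fun v hv => ⟨hv.1, hv.2 ▸ hq⟩
  have hg : ∀ q, ∃ g : ℕ → ℕ, q ≠ q₀ → Set.MapsTo g (D i q) (D j q) ∧ Set.InjOn g (D i q) := by
    intro q
    by_cases hq : q = q₀
    · exact ⟨_root_.id, fun h => absurd hq h⟩
    obtain ⟨g, hg, hinj⟩ := (hDfin i q hq).exists_injOn_of_encard_le (t := D j q) (by
      rw [← (hDfin i q hq).cast_ncard_eq, ← (hDfin j q hq).cast_ncard_eq]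
      exact_mod_cast hcard q)
    exact ⟨g, fun _ => ⟨hg, hinj⟩⟩
  choose g hg using hg
  let g' : ℕ → ℕ := fun v => if v ∈ X then v else g (col i v) v
  have hgX : ∀ x ∈ X, g' x = x := fun x hx => if_pos hx
  have hgB : ∀ v ∈ B i, g' v ∉ X ∧ col j (g' v) = col i v := by
    intro v hv
    have h1 : g' v = g (col i v) v := if_neg hv.1
    rw [h1]
    exact (hg (col i v) hv.2).1 ⟨hv.1, rfl⟩
  obtain ⟨π, hord, hπY, hπ⟩ := exists_perm_extending (Y := X ∪ (B i ∪ B j)) (A := X ∪ B i)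
    (g := g') (hX.union ((hB i).union (hB j)))
    (Set.union_subset_union_right _ Set.subset_union_left) (by
      rintro v (hv | hv)
      · rw [hgX v hv]
        exact .inl hv
      · have h1 := hgB v hv
        exact .inr (.inr ⟨h1.1, h1.2 ▸ hv.2⟩)) (by
      rintro v (hv | hv) w (hw | hw) hvw
      · rwa [hgX v hv, hgX w hw] at hvw
      · rw [hgX v hv] at hvw
        exact absurd (hvw ▸ hv) (hgB w hw).1
      · rw [hgX w hw] at hvw
        exact absurd (hvw ▸ hw) (hgB v hv).1
      · have h1 : col i v = col i w := by rw [← (hgB v hv).2, ← (hgB w hw).2, hvw]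
        simp only [g', if_neg hv.1, if_neg hw.1, ← h1] at hvw
        exact (hg (col i v) hv.2).2 ⟨hv.1, rfl⟩ ⟨hw.1, h1.symm⟩ hvw)
  have hfin : {x | π x ≠ x}.Finite := (hX.union ((hB i).union (hB j))).subset fun x hx => by
    by_contra h
    exact hx (hπY x h)
  have hπX : ∀ x ∈ X, π x = x := fun x hx => (hπ x (.inl hx)).trans (hgX x hx)
  let l : Subst F :=
    { toFun := fun u => if u ∈ X ∪ B i then .var (π u) else (f j).toFun (π u)
      finite_dom := by
        refine (hfin.union (f j).finite_dom).subset fun x hx => ?_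
        by_contra h
        simp only [Set.mem_union, Set.mem_ofPred_eq, not_or, not_not] at h
        refine hx ?_
        simp only [h.1, h.2, ite_self] }
  have hl : ∀ u ∈ X ∪ B i, l.toFun u = .var (π u) := fun u hu => if_pos hu
  have hlX : ∀ x ∈ X, l.toFun x = .var x := fun x hx => by rw [hl x (.inl hx), hπX x hx]
  have key : ∀ u, EqE E (((f i).toFun u).subst l.toFun) ((f j).toFun (π u)) := by
    intro u
    by_cases huX : u ∈ X
    · rw [hπX u huX, Term.subst_eq_self fun x hx => hlX x ((hf i).1 u huX hx)]
      exact hc _ _ (((hf i).1 u huX).trans (Set.subset_insert _ _)) (congrFun hshape ⟨u, huX⟩)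
    by_cases hu : u ∈ B i
    · have h1 := hgB u hu
      rw [← hπ u (.inr hu)] at h1
      refine hcol i j u huX (π u) h1.1 h1.2.symm l.toFun hlX (hl u (.inr hu))
    · have h0 : col i u = q₀ := by
        by_contra h
        exact hu ⟨huX, h⟩
      exact ((hcol₀ i u huX h0).subst l.toFun).trans
        (EqE.of_eq (if_neg fun h => h.elim huX hu))
  refine ⟨i, j, hij, π.symm, perm_symm_support_finite hfin, ?_, l, fun x _ => ?_⟩
  · exact hord.inv
  · have := key (π.symm x)
    rwa [Equiv.apply_symm_apply] at this

theorem InstLE.of_precomp {E : Set (Term F × Term F)} {σ τ : Subst F} {π : Equiv.Perm ℕ}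
    {hπ : {x | π x ≠ x}.Finite} (hord : IsOfFinOrder π) (h₁ : InstLE E Set.univ τ σ)
    (h₂ : InstLE E Set.univ (σ.precomp π hπ) τ) : InstLE E Set.univ σ τ := by
  obtain ⟨l, hl⟩ := h₂.trans h₁
  have hiter : ∀ k : ℕ, ∃ m : Subst F, ∀ x,
      EqE E ((σ.toFun ((π ^ (k + 1)) x)).subst m.toFun) (σ.toFun (π x)) := by
    intro k
    induction k with
    | zero => exact ⟨Subst.id, fun x => EqE.of_eq (by rw [zero_add, pow_one]; exact Term.subst_var _)⟩
    | succ k ih =>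
      obtain ⟨m, hm⟩ := ih
      refine ⟨m.comp l, fun x => ?_⟩
      have h1 := (hl ((π ^ (k + 1)) x) trivial).subst m.toFun
      rw [Term.subst_subst] at h1
      rw [pow_succ', Equiv.Perm.mul_apply]
      exact h1.trans (hm x)
  obtain ⟨n, hn, hpow⟩ := hord.exists_pow_eq_one
  obtain ⟨k, rfl⟩ := Nat.exists_eq_succ_of_ne_zero hn.ne'
  obtain ⟨m, hm⟩ := hiter k
  refine InstLE.trans ⟨m, fun x _ => ?_⟩ h₂
  have := hm x
  rwa [← Nat.succ_eq_add_one, hpow] at this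

theorem LocallyFinite.noetherian {E : Set (Term F × Term F)} (hlf : LocallyFinite E)
    (hreg : Regular E) : Noetherian E := by
  rintro ⟨f, hf⟩
  have hle : ∀ i j, i ≤ j → InstLE E Set.univ (f j) (f i) := by
    intro i j hij
    induction hij with
    | refl => exact .refl _ _ _
    | step _ ih => exact (hf _).1.trans ih
  let X : Set ℕ := (f 0).Dom ∪ (f 0).VRan
  have hX : X.Finite := (f 0).finite_dom.union
    ((f 0).finite_dom.biUnion fun x _ => Term.vars_finite _)
  have hout : ∀ v ∉ (f 0).Dom, (f 0).toFun v = .var v := fun v hv => not_not.1 hv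
  have hnormal : ∀ n, ∃ τ : Subst F, NormalOn X τ ∧ InstEquiv E Set.univ (f n) τ := by
    intro n
    refine exists_normalOn hreg hX (fun v hv => hout v fun h => hv (.inl h)) ?_ (hle 0 n n.zero_le)
    intro x hx
    by_cases hxd : x ∈ (f 0).Dom
    · exact fun z hz => .inr (Set.mem_biUnion hxd hz)
    · rw [hout x hxd]
      rintro _ rfl
      exact hx
  choose g hg hfg using hnormal
  obtain ⟨i, j, hij, π, hπ, hord, h⟩ := hlf.exists_precomp_instLE hX hg
  have hji : InstLE E Set.univ (g j) (g i) := ((hfg j).2.trans (hle i j hij.le)).trans (hfg i).1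
  have h1 : InstLE E Set.univ (f i) (f j) :=
    ((hfg i).1.trans (InstLE.of_precomp hord hji h)).trans (hfg j).2
  exact (hf i).2 (h1.trans (hle (i + 1) j hij))

/-! ### A problem without finite complete sets -/

theorem surjective_of_injective_of_finite_support {f : ℕ → ℕ} (hinj : Function.Injective f)
    (hfin : {x | f x ≠ x}.Finite) : Function.Surjective f := by
  have hmaps : Set.MapsTo f {x | f x ≠ x} {x | f x ≠ x} := fun x hx h => hx (hinj h)
  intro y
  by_cases hy : f y = y
  · exact ⟨y, hy⟩
  · obtain ⟨x, -, hx⟩ := ((hfin.injOn_iff_bijOn_of_mapsTo hmaps).1 hinj.injOn).surjOn hy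
    exact ⟨x, hx⟩

/-- The term `xyx`. -/
def wing (x y : ℕ) : Term SigF := fT (.var x) (fT (.var y) (.var x))

/-- The problem `xyx ≈ xzx`. -/
def wingProblem (b : F 2) : Set (Term F × Term F) := {(embed b (wing 0 1), embed b (wing 0 2))}

/-- Images for a unifier of `xyx ≈ xzx` in which `x`, `y`, `z` become `abca`, `dbd`, `dcd` with
`a = 0`, `b = 1`, `c = 2`, `d = w`. -/
def wingTerm (w : ℕ) : ℕ → Term SigF
  | 0 => fT (.var 0) (fT (.var 1) (fT (.var 2) (.var 0)))
  | 1 => wing w 1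
  | 2 => wing w 2
  | n => .var n

/-- The unifier of `xyx ≈ xzx` with the images `wingTerm w`. -/
def wingSubst (b : F 2) (w : ℕ) : Subst F where
  toFun x := embed b (wingTerm w x)
  finite_dom := (Set.finite_lt_nat 3).subset fun x hx => by
    by_contra h
    match x, h with
    | 0, h => exact h (by simp)
    | 1, h => exact h (by simp)
    | 2, h => exact h (by simp)
    | n + 3, _ => exact hx rfl

theorem embed_subst (b : F 2) (t : Term SigF) (σ : ℕ → Term SigF) :
    (embed b t).subst (fun x => embed b (σ x)) = embed b (t.subst σ) := by
  induction t using fT_induction with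
  | hv x => rfl
  | hm s t hs ht =>
    have h1 : embed b (fT s t) = .app 2 b ![embed b s, embed b t] := rfl
    have h2 : (fT s t).subst σ = fT (s.subst σ) (t.subst σ) := subst_app_two s t σ
    have h3 : embed b (fT (s.subst σ) (t.subst σ)) =
      .app 2 b ![embed b (s.subst σ), embed b (t.subst σ)] := rfl
    rw [h1, h2, h3, subst_app_two, hs, ht]

section WingProblem

variable {E : Set (Term F × Term F)} {b : F 2}

theorem band_absorb {S : Type*} [Semigroup S] (h : ∀ x : S, x * x = x) {x d e : S}
    (hs : x * (d * x) * (x * (d * (e * d) * x)) * (x * (d * x)) = x * (d * x)) :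
    x * (d * (e * d) * x) = x * (d * x) := by
  have h1 : x * (d * x) * (x * (d * (e * d) * x)) = x * (d * (e * d) * x) := calc
    _ = x * d * (x * x) * d * e * d * x := by simp only [mul_assoc]
    _ = (x * d) * (x * d) * e * d * x := by rw [h x]; simp only [mul_assoc]
    _ = _ := by rw [h (x * d)]; simp only [mul_assoc]
  have h2 : x * (d * (e * d) * x) * (x * (d * x)) = x * (d * (e * d) * x) := calc
    _ = x * d * e * (d * (x * x) * (d * x)) := by simp only [mul_assoc]
    _ = x * d * e * (d * x * (d * x)) := by rw [h x]
    _ = _ := by rw [h (d * x)]; simp only [mul_assoc]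
  rw [← hs, h1, h2]

theorem interp_wing_absorb {S : Type*} [Semigroup S] (h : ∀ x : S, x * x = x) {ν : ℕ → S}
    {x e : Term SigF} {d : ℕ} (he : e.vars ⊆ x.vars) :
    interp ν (fT x (fT (fT (.var d) (fT e (.var d))) x)) = interp ν (fT x (fT (.var d) x)) := by
  set p := fT x (fT (.var d) x) with hp
  have hs := interp_sandwich h (ν := ν) (x := p)
    (t := fT x (fT (fT (.var d) (fT e (.var d))) x)) (by
      simp only [hp, vars_fT]
      intro z hz
      simp only [Set.mem_union] at hz ⊢
      have := @he z
      tauto)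
  simp only [hp, interp_fT] at hs ⊢
  exact band_absorb h hs

theorem unifier_wingSubst (hb : IsBandOp E b) (w : ℕ) :
    Unifier E (wingProblem b) (wingSubst b w) := by
  rintro _ rfl
  obtain ⟨_, ν, hidem, hν⟩ := exists_interp_quotient hb
  have h1 : ∀ t : Term SigF, (embed b t).subst (wingSubst b w).toFun =
    embed b (t.subst (wingTerm w)) := fun t => embed_subst b t _
  rw [h1, h1, hν]
  have h2 : ∀ k, (wing 0 k).subst (wingTerm w) =
      fT (wingTerm w 0) (fT (wingTerm w k) (wingTerm w 0)) := by
    intro k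
    simp only [wing, fT, subst_app_two]
    rfl
  rw [h2, h2]
  have h3 : ∀ k, k ∈ (wingTerm w 0).vars → (Term.var k : Term SigF).vars ⊆ (wingTerm w 0).vars := by
    rintro k hk _ rfl
    exact hk
  exact (interp_wing_absorb hidem (h3 1 (by simp [wingTerm, vars_fT, Term.vars]))).trans
    (interp_wing_absorb hidem (h3 2 (by simp [wingTerm, vars_fT, Term.vars]))).symm

theorem not_finite_complete_wingProblem (hE : Regular E) (hb : IsBandOp E b)
    {S : Set (Subst F)} (hS : S.Finite) : ¬ CompleteSet E (wingProblem b) Set.univ S := by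
  intro hC
  have hfin : ({0, 1, 2} ∪ ⋃ τ ∈ S, (τ.Dom ∪ τ.VRan)).Finite :=
    (Set.toFinite _).union (hS.biUnion fun τ _ => τ.finite_dom.union
      (τ.finite_dom.biUnion fun x _ => Term.vars_finite _))
  obtain ⟨w, hw⟩ := hfin.exists_notMem
  obtain ⟨τ, hτS, l, hl⟩ := hC.2 _ (unifier_wingSubst hb w)
  have hτ := hC.1 τ hτS _ rfl
  simp only [Set.mem_union, Set.mem_insert_iff, Set.mem_singleton_iff, Set.mem_iUnion,
    not_or, not_exists] at hw
  obtain ⟨⟨hw0, hw1, hw2⟩, hw⟩ := hw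
  have hout : ∀ v ∉ τ.Dom, τ.toFun v = .var v := fun v hv => not_not.1 hv
  have hwfix : ∀ x ≠ w, w ∉ (τ.toFun x).vars := by
    intro x hx hwx
    by_cases hxd : x ∈ τ.Dom
    · exact (hw τ hτS).2 (Set.mem_biUnion hxd hwx)
    · rw [hout x hxd] at hwx
      exact hx hwx.symm
  have hvars : ∀ x z, z ∈ (wingTerm w x).vars ↔
      ∃ y ∈ (τ.toFun x).vars, z ∈ (l.toFun y).vars := by
    intro x z
    have := EqE.vars_eq hE (hl x trivial)
    rw [← vars_embed b, ← Term.mem_vars_subst, this]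
    rfl
  have hcontent : ∀ y, (y ∈ (τ.toFun 0).vars ∨ y ∈ (τ.toFun 1).vars) ↔
      (y ∈ (τ.toFun 0).vars ∨ y ∈ (τ.toFun 2).vars) := by
    intro y
    have h1 := EqE.vars_eq hE hτ
    have h2 : ∀ k, ((embed b (wing 0 k)).subst τ.toFun).vars =
        (τ.toFun 0).vars ∪ (τ.toFun k).vars := by
      intro k
      ext z
      simp [Term.mem_vars_subst, vars_embed, wing, vars_fT, Term.vars, or_comm]
    simp only [h2] at h1
    exact Set.ext_iff.1 h1 y
  have h0 : ∀ z, z ∈ (wingTerm w 0).vars ↔ z = 0 ∨ z = 1 ∨ z = 2 := by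
    intro z
    simp [wingTerm, vars_fT, Term.vars]
    tauto
  have h1 : ∀ z, z ∈ (wingTerm w 1).vars ↔ z = 1 ∨ z = w := by
    intro z
    simp [wingTerm, wing, vars_fT, Term.vars]
  have h2 : ∀ z, z ∈ (wingTerm w 2).vars ↔ z = 2 ∨ z = w := by
    intro z
    simp [wingTerm, wing, vars_fT, Term.vars]
  have h3 : ∀ v, v ≠ 0 → v ≠ 1 → v ≠ 2 → wingTerm w v = .var v := by
    intro v hv0 hv1 hv2
    match v with
    | n + 3 => rfl
  obtain ⟨α, -, hαl⟩ := (hvars 0 0).1 ((h0 0).2 (by simp))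
  obtain ⟨β, hβ1, hβl⟩ := (hvars 1 1).1 ((h1 1).2 (by simp))
  obtain ⟨γ, hγ2, hγl⟩ := (hvars 2 2).1 ((h2 2).2 (by simp))
  obtain ⟨δ, hδ1, hδl⟩ := (hvars 1 w).1 ((h1 w).2 (by simp))
  have hα1 : α ∉ (τ.toFun 1).vars := fun h => by
    have := (h1 0).1 ((hvars 1 0).2 ⟨α, h, hαl⟩)
    omega
  have hα2 : α ∉ (τ.toFun 2).vars := fun h => by
    have := (h2 0).1 ((hvars 2 0).2 ⟨α, h, hαl⟩)
    omega
  have hβ2 : β ∉ (τ.toFun 2).vars := fun h => by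
    have := (h2 1).1 ((hvars 2 1).2 ⟨β, h, hβl⟩)
    omega
  have hγ1 : γ ∉ (τ.toFun 1).vars := fun h => by
    have := (h1 2).1 ((hvars 1 2).2 ⟨γ, h, hγl⟩)
    omega
  have hδ0 : δ ∉ (τ.toFun 0).vars := fun h => by
    have := (h0 w).1 ((hvars 0 w).2 ⟨δ, h, hδl⟩)
    omega
  have hβ0 : β ∈ (τ.toFun 0).vars := ((hcontent β).1 (.inr hβ1)).resolve_right hβ2
  have hγ0 : γ ∈ (τ.toFun 0).vars := ((hcontent γ).2 (.inr hγ2)).resolve_right hγ1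
  have hy : ∀ v, ∃ y, v ≠ 0 → v ≠ 1 → v ≠ 2 →
      y ∈ (τ.toFun v).vars ∧ (l.toFun y).vars = {v} := by
    intro v
    by_cases hv : v ≠ 0 ∧ v ≠ 1 ∧ v ≠ 2
    · have h4 := h3 v hv.1 hv.2.1 hv.2.2
      obtain ⟨y, hy, hyl⟩ := (hvars v v).1 (by rw [h4]; rfl)
      refine ⟨y, fun _ _ _ => ⟨hy, Set.Subset.antisymm (fun z hz => ?_) (by simpa using hyl)⟩⟩
      have := (hvars v z).2 ⟨y, hy, hz⟩
      rwa [h4] at this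
    · exact ⟨0, fun a b c => absurd ⟨a, b, c⟩ hv⟩
  choose y hy using hy
  have hyne : ∀ v ≥ 3, ∀ u, ∀ k ∈ (l.toFun u).vars, y v = u → k = v := by
    rintro v hv _ k hk rfl
    rw [(hy v (by omega) (by omega) (by omega)).2] at hk
    exact hk
  let g : ℕ → ℕ := fun v => match v with
    | 0 => α
    | 1 => β
    | 2 => γ
    | v => y v
  have hg3 : ∀ v ≥ 3, g v = y v := by
    intro v hv
    match v with
    | n + 3 => rfl
  have hginj : Function.Injective g := by
    have key : ∀ v v', v < v' → g v ≠ g v' := by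
      intro v v' hvv' h
      match v, v' with
      | 0, 1 => exact hα1 ((show α = β from h) ▸ hβ1)
      | 0, 2 => exact hα2 ((show α = γ from h) ▸ hγ2)
      | 1, 2 => exact hβ2 ((show β = γ from h) ▸ hγ2)
      | 0, n + 3 => simpa using hyne (n + 3) (by omega) α 0 hαl h.symm
      | 1, n + 3 => simpa using hyne (n + 3) (by omega) β 1 hβl h.symm
      | 2, n + 3 => simpa using hyne (n + 3) (by omega) γ 2 hγl h.symm
      | m + 3, n + 3 =>
        have h4 := (hy (m + 3) (by omega) (by omega) (by omega)).2
        have := hyne (n + 3) (by omega) (y (m + 3)) (m + 3) (by rw [h4]; rfl) h.symm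
        omega
    intro v v' h
    rcases lt_trichotomy v v' with h' | h' | h'
    · exact absurd h (key _ _ h')
    · exact h'
    · exact absurd h.symm (key _ _ h')
  have hgfin : {x | g x ≠ x}.Finite := by
    refine ((Set.finite_lt_nat 3).union τ.finite_dom).subset fun x hx => ?_
    by_contra hn
    simp only [Set.mem_union, Set.mem_ofPred_eq, not_or, not_not, not_lt] at hn
    have h4 := (hy x (by omega) (by omega) (by omega)).1
    rw [hn.2] at h4
    exact hx ((hg3 x hn.1).trans h4)
  obtain ⟨v, hv⟩ := surjective_of_injective_of_finite_support hginj hgfin δ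
  match v with
  | 0 => exact hα1 ((show α = δ from hv) ▸ hδ1)
  | 1 => exact hδ0 ((show β = δ from hv) ▸ hβ0)
  | 2 => exact hδ0 ((show γ = δ from hv) ▸ hγ0)
  | n + 3 =>
    have hv' : y (n + 3) = δ := hv
    obtain rfl : w = n + 3 := hyne (n + 3) (by omega) δ w hδl hv'
    have h4 := (hy (n + 3) (by omega) (by omega) (by omega)).1
    rw [hout _ fun h => (hw τ hτS).1 h] at h4
    have h5 : y (n + 3) = n + 3 := h4
    rw [← hv', h5] at hδ1
    exact hwfix 1 (by omega) hδ1

end WingProblem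

/-- Unrestricted unification modulo a regular, locally finite theory with a band operation is
infinitary. -/
theorem IsBandOp.unrestrictedTypeInfinitary {E : Set (Term F × Term F)} {b : F 2}
    (hb : IsBandOp E b) (hreg : Regular E) (hlf : LocallyFinite E) :
    UnrestrictedTypeInfinitary E := by
  have hN := hlf.noetherian hreg
  obtain ⟨S, hS⟩ := hN.exists_minimalComplete (wingProblem b)
  refine ⟨fun Γ _ _ => hN.exists_minimalComplete Γ, wingProblem b, Set.finite_singleton _,
    ⟨_, unifier_wingSubst hb 0⟩, ⟨S, fun hfin => ?_, hS⟩, ?_⟩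
  · exact not_finite_complete_wingProblem hreg hb hfin hS.1
  · rintro ⟨T, hT, hTm⟩
    exact not_finite_complete_wingProblem hreg hb hT hTm.1

/-! ### The theories `AI`, `ACI` and `ACUI` -/

theorem subst_fT (s t : Term SigF) (σ : ℕ → Term SigF) :
    (fT s t).subst σ = fT (s.subst σ) (t.subst σ) := subst_app_two s t σ

theorem subst_fU (s t : Term SigFU) (σ : ℕ → Term SigFU) :
    (fU s t).subst σ = fU (s.subst σ) (t.subst σ) := subst_app_two s t σ

theorem vars_fU (s t : Term SigFU) : (fU s t).vars = s.vars ∪ t.vars := vars_app_two s t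

theorem vars_zeroT : zeroT.vars = ∅ := by
  simp [zeroT, Term.vars]

theorem isBandOp_of_AITheory_subset {E : Set (Term SigF × Term SigF)} (h : AITheory ⊆ E) :
    IsBandOp E SigF.f := by
  constructor
  · intro s t u
    have := EqE.ax (E := E) (fun x => match x with | 0 => s | 1 => t | _ => u) (h (.inl rfl))
    simp only [subst_fT] at this
    exact this
  · intro s
    have := EqE.ax (E := E) (fun _ => s) (h (.inr rfl))
    simp only [subst_fT] at this
    exact this

theorem embed_f (t : Term SigF) : embed SigF.f t = t := by
  induction t using fT_induction with
  | hv x => rfl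
  | hm s t hs ht =>
    have : embed SigF.f (fT s t) = fT (embed SigF.f s) (embed SigF.f t) := rfl
    rw [this, hs, ht]

theorem unrestrictedTypeInfinitary_of_AITheory_subset {E : Set (Term SigF × Term SigF)}
    (h : AITheory ⊆ E) (hreg : Regular E) : UnrestrictedTypeInfinitary E := by
  have hb := isBandOp_of_AITheory_subset h
  refine hb.unrestrictedTypeInfinitary hreg (hb.locallyFinite Set.finite_empty fun t => ?_)
  exact .inr ⟨t, subset_rfl, EqE.of_eq (embed_f t).symm⟩

theorem regular_AITheory : Regular AITheory := by
  rintro _ (rfl | rfl)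
  · simp only [vars_fT, Set.union_assoc]
  · simp only [vars_fT, Set.union_self]

theorem regular_ACITheory : Regular ACITheory := by
  rintro _ (rfl | rfl | rfl)
  · simp only [vars_fT, Set.union_assoc]
  · simp only [vars_fT, Set.union_comm]
  · simp only [vars_fT, Set.union_self]

theorem AITheory_subset_ACITheory : AITheory ⊆ ACITheory := by
  rintro _ (rfl | rfl)
  · exact .inl rfl
  · exact .inr (.inr rfl)

theorem regular_ACUITheory : Regular ACUITheory := by
  rintro _ (rfl | rfl | rfl | rfl)
  · simp only [vars_fU, Set.union_assoc]
  · simp only [vars_fU, Set.union_comm]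
  · simp only [vars_fU, vars_zeroT, Set.union_empty]
  · simp only [vars_fU, Set.union_self]

theorem isBandOp_ACUITheory : IsBandOp ACUITheory SigFU.f := by
  constructor
  · intro s t u
    have := EqE.ax (E := ACUITheory) (fun x => match x with | 0 => s | 1 => t | _ => u) (.inl rfl)
    simp only [subst_fU] at this
    exact this
  · intro s
    have := EqE.ax (E := ACUITheory) (fun _ => s) (.inr (.inr (.inr rfl)))
    simp only [subst_fU] at this
    exact this

theorem ACUITheory_comm (s t : Term SigFU) : EqE ACUITheory (fU s t) (fU t s) := by
  have := EqE.ax (E := ACUITheory) (fun x => match x with | 0 => s | _ => t) (.inr (.inl rfl))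
  simp only [subst_fU] at this
  exact this

theorem ACUITheory_zero (s : Term SigFU) : EqE ACUITheory (fU s zeroT) s := by
  have := EqE.ax (E := ACUITheory) (fun _ => s) (.inr (.inr (.inl rfl)))
  have h0 : zeroT.subst (fun _ => s) = zeroT := by
    simp only [zeroT, Term.subst]
    congr 1
    exact Subsingleton.elim _ _
  simp only [subst_fU, h0] at this
  exact this

theorem ACUITheory_eq_zero_or_embed (t : Term SigFU) : EqE ACUITheory t zeroT ∨
    ∃ s : Term SigF, s.vars ⊆ t.vars ∧ EqE ACUITheory t (embed SigFU.f s) := by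
  induction t with
  | var x => exact .inr ⟨.var x, subset_rfl, EqE.refl _⟩
  | app n g ts ih =>
    cases g with
    | zero => exact .inl (EqE.of_eq (congrArg _ (Subsingleton.elim _ _)))
    | f =>
      have hts : ts = ![ts 0, ts 1] := by
        funext i
        fin_cases i <;> rfl
      rw [hts]
      change EqE _ (fU (ts 0) (ts 1)) _ ∨ ∃ s : Term SigF, _ ⊆ (fU (ts 0) (ts 1)).vars ∧
        EqE _ (fU (ts 0) (ts 1)) _
      rw [vars_fU]
      rcases ih 0 with h0 | ⟨s, hs, h0⟩ <;> rcases ih 1 with h1 | ⟨t, ht, h1⟩ <;>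
        have h := EqE.app_two SigFU.f h0 h1
      · exact .inl (h.trans (ACUITheory_zero _))
      · exact .inr ⟨t, ht.trans Set.subset_union_right,
          h.trans ((ACUITheory_comm _ _).trans (ACUITheory_zero _))⟩
      · exact .inr ⟨s, hs.trans Set.subset_union_left, h.trans (ACUITheory_zero _)⟩
      · exact .inr ⟨fT s t, by rw [vars_fT]; exact Set.union_subset_union hs ht, h⟩

/-- Theorem `AI:ACI:thm`: the unrestricted unification type
of `AI`, `ACI`, and `ACUI` for elementary unification is infinitary. -/
theorem stmt18 : UnrestrictedTypeInfinitary AITheory ∧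
    UnrestrictedTypeInfinitary ACITheory ∧ UnrestrictedTypeInfinitary ACUITheory := by
  refine ⟨unrestrictedTypeInfinitary_of_AITheory_subset subset_rfl regular_AITheory,
    unrestrictedTypeInfinitary_of_AITheory_subset AITheory_subset_ACITheory regular_ACITheory,
    isBandOp_ACUITheory.unrestrictedTypeInfinitary regular_ACUITheory
      (isBandOp_ACUITheory.locallyFinite (Set.finite_singleton zeroT) fun t => ?_)⟩
  rcases ACUITheory_eq_zero_or_embed t with h | h
  · exact .inl ⟨zeroT, rfl, h⟩
  · exact .inr h
end UnifFW
end
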